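/- Let 1 ≤ p₁ < 2. Then there is a positive constant C, independent of N and n, such that for all N ∈ ℕ: the n-th Kolmogorov number of the identity map from ℓ_{p₁}^N to ℓ_∞^N satisfies d_n(id : ℓ_{p₁}^N → ℓ_∞^N) ≤ C · n^{-1/2} · (log(4eN/n))^{3/2} whenever 1 ≤ n ≤ N, and d_n(id : ℓ_{p₁}^N → ℓ_∞^N) = 0 whenever n > N. -/

import Mathlib

open scoped ENNReal BigOperators

/-- The ℓ_p quasi-norm on ℝ^N, for `p : ℝ≥0∞` (with `p = ∞` giving the sup-norm). -/
noncomputable def pNorm (p : ℝ≥0∞) {N : ℕ} (x : Fin N → ℝ) : ℝ :=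
  if p = ∞ then ⨆ i, |x i| else (∑ i, |x i| ^ p.toReal) ^ (1 / p.toReal)

/-- The n-th Kolmogorov number of the identity map `id : ℓ_p^N → ℓ_q^N`. -/
noncomputable def kolmogorovNumber (p q : ℝ≥0∞) (N n : ℕ) : ℝ :=
  sInf { r : ℝ | ∃ V : Submodule ℝ (Fin N → ℝ), Module.finrank ℝ (↥V) < n ∧
    r = sSup { s : ℝ | ∃ x : Fin N → ℝ, pNorm p x ≤ 1 ∧
      s = sInf { t : ℝ | ∃ v ∈ V, t = pNorm q (x - v) } } }

/-- The n-th Gelfand number of the identity map `id : ℓ_p^N → ℓ_q^N`. -/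
noncomputable def gelfandNumber (p q : ℝ≥0∞) (N n : ℕ) : ℝ :=
  sInf { r : ℝ | ∃ M : Submodule ℝ (Fin N → ℝ), N - Module.finrank ℝ (↥M) < n ∧
    r = sSup { s : ℝ | ∃ x ∈ M, pNorm p x ≤ 1 ∧ s = pNorm q x } }

/-- The n-th approximation number of the identity map `id : ℓ_p^N → ℓ_q^N`. -/
noncomputable def approxNumber (p q : ℝ≥0∞) (N n : ℕ) : ℝ :=
  sInf { r : ℝ | ∃ L : (Fin N → ℝ) →ₗ[ℝ] (Fin N → ℝ),
    Module.finrank ℝ (↥(LinearMap.range L)) < n ∧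
    r = sSup { s : ℝ | ∃ x : Fin N → ℝ, pNorm p x ≤ 1 ∧ s = pNorm q (x - L x) } }

/-- The sign `±1` encoded by a Boolean. -/
def boolSign (b : Bool) : ℝ := if b then 1 else -1

lemma boolSign_sq (b : Bool) : boolSign b ^ 2 = 1 := by cases b <;> norm_num [boolSign]

/-- The signed sum of the coordinates of `z`, as a linear functional of `z`. -/
def signSum {N : ℕ} (ε : Fin N → Bool) : (Fin N → ℝ) →ₗ[ℝ] ℝ :=
  ∑ i, boolSign (ε i) • LinearMap.proj i

lemma signSum_apply {N : ℕ} (ε : Fin N → Bool) (z : Fin N → ℝ) :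
    signSum ε z = ∑ i, boolSign (ε i) * z i := by
  simp [signSum]

lemma sum_signs_succ {N : ℕ} (z : Fin (N + 1) → ℝ) (f : ℝ → ℝ) :
    ∑ ε, f (signSum ε z) = ∑ ε : Fin N → Bool,
      (f (z 0 + signSum ε (Fin.tail z)) + f (-z 0 + signSum ε (Fin.tail z))) := by
  rw [← (Fin.consEquiv fun _ : Fin (N + 1) => Bool).sum_comp, Fintype.sum_prod_type,
    Fintype.sum_bool, ← Finset.sum_add_distrib]
  simp [signSum_apply, Fin.sum_univ_succ, Fin.consEquiv, boolSign, Fin.tail]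

lemma sum_signSum_sq {N : ℕ} (z : Fin N → ℝ) :
    ∑ ε, signSum ε z ^ 2 = 2 ^ N * ∑ i, z i ^ 2 := by
  induction N with
  | zero => simp [signSum_apply]
  | succ N ih =>
    rw [sum_signs_succ z (fun t => t ^ 2), Fin.sum_univ_succ]
    have key : ∀ q : ℝ, (z 0 + q) ^ 2 + (-z 0 + q) ^ 2 = 2 * z 0 ^ 2 + 2 * q ^ 2 := fun q => by ring
    simp only [key, Finset.sum_add_distrib, ← Finset.mul_sum, ih, Fin.tail]
    simp
    ring

lemma sum_signSum_pow_four_le {N : ℕ} (z : Fin N → ℝ) :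
    ∑ ε, signSum ε z ^ 4 ≤ 2 ^ N * (3 * (∑ i, z i ^ 2) ^ 2) := by
  induction N with
  | zero => simp [signSum_apply]
  | succ N ih =>
    rw [sum_signs_succ z (fun t => t ^ 4), Fin.sum_univ_succ]
    have key : ∀ q : ℝ, (z 0 + q) ^ 4 + (-z 0 + q) ^ 4
        = 2 * z 0 ^ 4 + 12 * z 0 ^ 2 * q ^ 2 + 2 * q ^ 4 := fun q => by ring
    simp only [key, Finset.sum_add_distrib, ← Finset.mul_sum, sum_signSum_sq]
    have h := ih (Fin.tail z)
    simp only [Fin.tail] at h ⊢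
    simp only [Finset.sum_const, Finset.card_univ, Fintype.card_fun, Fintype.card_bool,
      Fintype.card_fin, nsmul_eq_mul, Nat.cast_pow, Nat.cast_ofNat]
    have h2 : (0 : ℝ) ≤ 2 ^ N * z 0 ^ 4 := by positivity
    rw [pow_succ (2 : ℝ) N]
    nlinarith

lemma exp_neg_le_quadratic {t : ℝ} (ht : 0 ≤ t) : Real.exp (-t) ≤ 1 - t + t ^ 2 / 2 := by
  rw [Real.exp_neg, inv_le_iff_one_le_mul₀ (Real.exp_pos t)]
  have h := Real.quadratic_le_exp_of_nonneg ht
  have h3 : 0 ≤ 1 - t + t ^ 2 / 2 := by nlinarith [sq_nonneg (t - 1)]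
  calc (1 : ℝ) ≤ (1 - t + t ^ 2 / 2) * (1 + t + t ^ 2 / 2) := by nlinarith [sq_nonneg (t ^ 2)]
    _ ≤ _ := by gcongr

lemma sum_exp_neg_signSum_sq_le {N : ℕ} (z : Fin N → ℝ) (hz : 0 < ∑ i, z i ^ 2) :
    ∑ ε, Real.exp (-(signSum ε z ^ 2 / (3 * ∑ i, z i ^ 2))) ≤ 2 ^ N * Real.exp (-(1 / 6)) := by
  set S := ∑ i, z i ^ 2 with hS
  have h56 : (5 / 6 : ℝ) ≤ Real.exp (-(1 / 6)) := by
    have := Real.add_one_le_exp (-(1 / 6) : ℝ)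
    linarith
  calc ∑ ε, Real.exp (-(signSum ε z ^ 2 / (3 * S)))
      ≤ ∑ ε, (1 - signSum ε z ^ 2 / (3 * S) + (signSum ε z ^ 2 / (3 * S)) ^ 2 / 2) :=
        Finset.sum_le_sum fun ε _ => exp_neg_le_quadratic (by positivity)
    _ = ∑ ε : Fin N → Bool, (1 : ℝ) - (∑ ε, signSum ε z ^ 2) / (3 * S)
          + (∑ ε, signSum ε z ^ 4) / (18 * S ^ 2) := by
        rw [Finset.sum_add_distrib, Finset.sum_sub_distrib, Finset.sum_div, Finset.sum_div]
        congr 1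
        refine Finset.sum_congr rfl fun ε _ => ?_
        field_simp
        ring
    _ ≤ 2 ^ N - 2 ^ N * S / (3 * S) + 2 ^ N * (3 * S ^ 2) / (18 * S ^ 2) := by
        rw [sum_signSum_sq]
        gcongr
        · simp
        · exact sum_signSum_pow_four_le z
    _ = 2 ^ N * (5 / 6) := by field_simp; ring
    _ ≤ _ := by gcongr

/-- A union bound: few vectors admit a sign matrix that shrinks none of them substantially. -/
lemma exists_signs_sq_sum_ge {ι : Type*} [Fintype ι] {N m : ℕ} (Z : ι → Fin N → ℝ)
    (h : (Fintype.card ι : ℝ) * Real.exp (-(m / 12)) < 1) :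
    ∃ A : Fin m → Fin N → Bool, ∀ a,
      m * (∑ i, Z a i ^ 2) / 4 ≤ ∑ r, signSum (A r) (Z a) ^ 2 := by
  by_contra! hcon
  let S : ι → ℝ := fun a => ∑ i, Z a i ^ 2
  let f : ι → (Fin m → Fin N → Bool) → ℝ := fun a A =>
    if 0 < S a then Real.exp (m / 12 - (∑ r, signSum (A r) (Z a) ^ 2) / (3 * S a)) else 0
  have hf : ∀ a A, 0 ≤ f a A := fun a A => by dsimp only [f]; split_ifs <;> positivity
  have h1 : ∀ A, 1 ≤ ∑ a, f a A := by
    intro A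
    obtain ⟨a, ha⟩ := hcon A
    refine le_trans ?_ (Finset.single_le_sum (f := fun b => f b A) (fun b _ => hf b A) (Finset.mem_univ a))
    have hq : 0 ≤ ∑ r, signSum (A r) (Z a) ^ 2 := by positivity
    have hS0 : 0 ≤ S a := Finset.sum_nonneg fun i _ => sq_nonneg (Z a i)
    have hpos : 0 < S a := by
      rcases hS0.eq_or_lt with h0 | h0
      · change _ < m * S a / 4 at ha
        rw [← h0] at ha
        linarith
      · exact h0
    dsimp only [f]
    rw [if_pos hpos]
    refine Real.one_le_exp ?_
    rw [sub_nonneg, div_le_iff₀ (by positivity)]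
    change _ < m * S a / 4 at ha
    linarith
  have h2 : ∀ a, ∑ A, f a A ≤ (2 ^ N) ^ m * Real.exp (-(m / 12)) := by
    intro a
    dsimp only [f]
    split_ifs with hpos
    · calc ∑ A : Fin m → Fin N → Bool,
            Real.exp (m / 12 - (∑ r, signSum (A r) (Z a) ^ 2) / (3 * S a))
          = Real.exp (m / 12) * ∑ A : Fin m → Fin N → Bool,
              ∏ r, Real.exp (-(signSum (A r) (Z a) ^ 2 / (3 * S a))) := by
            rw [Finset.mul_sum _ _ (Real.exp _)]
            refine Finset.sum_congr rfl fun A _ => ?_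
            rw [← Real.exp_sum, ← Real.exp_add, Finset.sum_neg_distrib, Finset.sum_div,
              sub_eq_add_neg]
        _ = Real.exp (m / 12) * (∑ ε, Real.exp (-(signSum ε (Z a) ^ 2 / (3 * S a)))) ^ m := by
            rw [Fintype.sum_pow]
        _ ≤ Real.exp (m / 12) * (2 ^ N * Real.exp (-(1 / 6))) ^ m := by
            gcongr
            exact sum_exp_neg_signSum_sq_le (Z a) hpos
        _ = _ := by
            rw [mul_pow, ← Real.exp_nat_mul, mul_left_comm, ← Real.exp_add]
            congr 2
            ring
    · simp only [Finset.sum_const_zero]; positivity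
  have h3 : ((2 : ℝ) ^ N) ^ m ≤ Fintype.card ι * ((2 ^ N) ^ m * Real.exp (-(m / 12))) := by
    calc ((2 : ℝ) ^ N) ^ m = ∑ A : Fin m → Fin N → Bool, (1 : ℝ) := by simp
      _ ≤ ∑ A, ∑ a, f a A := Finset.sum_le_sum fun A _ => h1 A
      _ = ∑ a, ∑ A, f a A := Finset.sum_comm
      _ ≤ ∑ a : ι, (2 ^ N) ^ m * Real.exp (-(m / 12)) := Finset.sum_le_sum fun a _ => h2 a
      _ = _ := by simp
  have h4 : (0 : ℝ) < (2 ^ N) ^ m := by positivity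
  nlinarith

/-- Maurey's empirical method: a convex combination is close to an equal-weight average. -/
lemma exists_sym_norm_sum_sub_sq_le {α E : Type*} [Fintype α] [NormedAddCommGroup E]
    [InnerProductSpace ℝ E] (X : α → E) (w : α → ℝ) (hw : ∀ a, 0 ≤ w a) (hw1 : ∑ a, w a = 1)
    {R : ℝ} (hX : ∀ a, ‖X a‖ ^ 2 ≤ R) (k : ℕ) :
    ∃ s : Sym α k, ‖((s : Multiset α).map X).sum - (k : ℝ) • ∑ a, w a • X a‖ ^ 2 ≤ k * R := by
  induction k with
  | zero => exact ⟨Sym.nil, by simp⟩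
  | succ k ih =>
    obtain ⟨s, hs⟩ := ih
    set y := ∑ a, w a • X a with hy
    set D := ((s : Multiset α).map X).sum - (k : ℝ) • y with hD
    have hlin : ∀ v : E, ∑ a, w a * inner ℝ v (X a) = inner ℝ v y := fun v => by
      simp [hy, inner_sum, real_inner_smul_right]
    have havg : ∑ a, w a * ‖D + (X a - y)‖ ^ 2 ≤ ∑ a, w a * ((k + 1) * R) := by
      have hexp : ∀ a, w a * ‖D + (X a - y)‖ ^ 2
          = w a * ‖D‖ ^ 2 + 2 * (w a * inner ℝ D (X a)) - w a * (2 * inner ℝ D y)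
            + w a * ‖X a‖ ^ 2 - 2 * (w a * inner ℝ y (X a)) + w a * ‖y‖ ^ 2 := fun a => by
        rw [norm_add_sq_real, norm_sub_sq_real (X a), inner_sub_right, real_inner_comm y (X a)]
        ring
      have hR : ∑ a, w a * ‖X a‖ ^ 2 ≤ R := by
        calc ∑ a, w a * ‖X a‖ ^ 2 ≤ ∑ a, w a * R :=
              Finset.sum_le_sum fun a _ => mul_le_mul_of_nonneg_left (hX a) (hw a)
          _ = R := by rw [← Finset.sum_mul, hw1, one_mul]
      simp only [hexp, Finset.sum_add_distrib, Finset.sum_sub_distrib, ← Finset.mul_sum, hlin,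
        ← Finset.sum_mul, hw1, real_inner_self_eq_norm_sq]
      nlinarith [sq_nonneg ‖y‖]
    obtain ⟨a, ha0, ha⟩ : ∃ a, 0 < w a ∧ ‖D + (X a - y)‖ ^ 2 ≤ (k + 1) * R := by
      by_contra! hcon
      refine havg.not_gt (Finset.sum_lt_sum (fun a _ => ?_) ?_)
      · rcases (hw a).eq_or_lt with h0 | h0
        · simp [← h0]
        · exact (mul_lt_mul_of_pos_left (hcon a h0) h0).le
      · obtain ⟨a, -, h0⟩ : ∃ a ∈ Finset.univ, 0 < w a :=
          Finset.exists_lt_of_sum_lt (by simp [hw1])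
        exact ⟨a, Finset.mem_univ a, mul_lt_mul_of_pos_left (hcon a h0) h0⟩
    refine ⟨a ::ₛ s, ?_⟩
    have : ((a ::ₛ s : Sym α (k + 1)) : Multiset α) = a ::ₘ (s : Multiset α) := Sym.coe_cons s a
    rw [this, Multiset.map_cons, Multiset.sum_cons]
    convert ha using 3
    · rw [hD]; push_cast; module
    · push_cast; rfl

/-- The signed basis vector `±eᵢ`. -/
def signedBasis {N : ℕ} (a : Fin N × Bool) : Fin N → ℝ := Pi.single a.1 (boolSign a.2)

lemma signSum_signedBasis_sq {N : ℕ} (ε : Fin N → Bool) (a : Fin N × Bool) :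
    signSum ε (signedBasis a) ^ 2 = 1 := by
  simp [signSum_apply, signedBasis, Pi.single_apply, mul_pow, boolSign_sq]

lemma sum_signedBasis_sq {N : ℕ} (a : Fin N × Bool) : ∑ i, signedBasis a i ^ 2 = 1 := by
  simp [signedBasis, Pi.single_apply, ite_pow, boolSign_sq]

lemma sum_smul_signedBasis {N : ℕ} (y : Fin N → ℝ) :
    ∑ a : Fin N × Bool, ((|y a.1| + boolSign a.2 * y a.1) / 2) • signedBasis a = y := by
  ext j
  simp only [Fintype.sum_prod_type, Fintype.sum_bool, signedBasis, boolSign, Finset.sum_apply,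
    Pi.smul_apply, Pi.single_apply, smul_eq_mul]
  rw [Finset.sum_eq_single j]
  · simp; ring
  · intro b _ hb
    simp [hb.symm]
  · simp

/-- The embedding `v ↦ (v, A v / √m)` attached to a sign matrix `A` with `m` rows. -/
noncomputable def graphEmbedding {N m : ℕ} (A : Fin m → Fin N → Bool) :
    (Fin N → ℝ) →ₗ[ℝ] EuclideanSpace ℝ (Fin N ⊕ Fin m) :=
  (WithLp.linearEquiv 2 ℝ (Fin N ⊕ Fin m → ℝ)).symm.toLinearMap ∘ₗ
    LinearMap.pi (Sum.elim (fun i => LinearMap.proj i) fun r => (√(m : ℝ))⁻¹ • signSum (A r))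

lemma norm_graphEmbedding_sq {N m : ℕ} (A : Fin m → Fin N → Bool) (v : Fin N → ℝ) :
    ‖graphEmbedding A v‖ ^ 2 = ∑ i, v i ^ 2 + (∑ r, signSum (A r) v ^ 2) / m := by
  rw [EuclideanSpace.norm_sq_eq, Fintype.sum_sum_type]
  simp [graphEmbedding, mul_pow, div_eq_inv_mul, Finset.mul_sum]

/-- If `A` shrinks no sum of `k` signed basis vectors, its kernel has small `ℓ₁ → ℓ₂` section. -/
lemma sum_sq_le_of_signSum_eq_zero {N m k : ℕ} (hm : 0 < m) (hk : 0 < k)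
    (A : Fin m → Fin N → Bool)
    (hA : ∀ s : Sym (Fin N × Bool) k,
      m * (∑ i, ((s : Multiset (Fin N × Bool)).map signedBasis).sum i ^ 2) / 4
        ≤ ∑ r, signSum (A r) ((s : Multiset (Fin N × Bool)).map signedBasis).sum ^ 2)
    (y : Fin N → ℝ) (hy : ∀ r, signSum (A r) y = 0) (hy1 : ∑ i, |y i| = 1) :
    ∑ i, y i ^ 2 ≤ 18 / k := by
  have hm' : (0 : ℝ) < m := by exact_mod_cast hm
  have hk' : (0 : ℝ) < k := by exact_mod_cast hk
  let T := graphEmbedding A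
  obtain ⟨s, hs⟩ := exists_sym_norm_sum_sub_sq_le (fun a => T (signedBasis a))
    (fun a : Fin N × Bool => (|y a.1| + boolSign a.2 * y a.1) / 2)
    (fun a => by
      have h1 := neg_abs_le (y a.1)
      have h2 := le_abs_self (y a.1)
      rcases a with ⟨i, _ | _⟩ <;> simp only [boolSign] at * <;> norm_num <;> linarith)
    (by
      rw [← hy1, Fintype.sum_prod_type]
      refine Finset.sum_congr rfl fun i _ => ?_
      simp [boolSign]; ring)
    (R := 2)
    (fun a => by
      simp only [T, norm_graphEmbedding_sq, sum_signedBasis_sq, signSum_signedBasis_sq]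
      simp [hm'.ne']; norm_num) k
  specialize hA s
  set z := ((s : Multiset (Fin N × Bool)).map signedBasis).sum with hz
  have hmap : ((s : Multiset (Fin N × Bool)).map fun a => T (signedBasis a)).sum = T z := by
    rw [hz, map_multiset_sum, Multiset.map_map]; rfl
  have hTy : ∑ a : Fin N × Bool, ((|y a.1| + boolSign a.2 * y a.1) / 2) • T (signedBasis a)
      = T y := by
    conv_rhs => rw [← sum_smul_signedBasis y]
    simp [map_sum]
  rw [hmap, hTy, ← map_smul, ← map_sub, norm_graphEmbedding_sq] at hs
  have hAz : ∀ r, signSum (A r) (z - (k : ℝ) • y) = signSum (A r) z := fun r => by simp [hy r]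
  simp only [hAz] at hs
  have h1 : (∑ i, z i ^ 2) / 4 ≤ (∑ r, signSum (A r) z ^ 2) / m := by
    rw [le_div_iff₀ hm']; linarith
  have h2 : 0 ≤ ∑ i, (z - (k : ℝ) • y) i ^ 2 := by positivity
  -- `|k y|² ≤ (3/2) |z|² + 3 |z - k y|²`
  have h3 : (k : ℝ) ^ 2 * ∑ i, y i ^ 2 ≤
      3 / 2 * ∑ i, z i ^ 2 + 3 * ∑ i, (z - (k : ℝ) • y) i ^ 2 := by
    rw [Finset.mul_sum, Finset.mul_sum, Finset.mul_sum, ← Finset.sum_add_distrib]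
    refine Finset.sum_le_sum fun i _ => ?_
    simp only [Pi.sub_apply, Pi.smul_apply, smul_eq_mul]
    nlinarith [sq_nonneg (3 * z i - 2 * (k * y i))]
  have h5 : (k : ℝ) ^ 2 * ∑ i, y i ^ 2 ≤ 18 * k := by linarith
  rw [le_div_iff₀ hk']
  nlinarith

/-- There is a sign matrix with `m` rows on whose kernel the `ℓ₂` norm is at most `√(18 / k)` times the `ℓ₁` norm. -/
lemma exists_signs_sum_sq_le {N m k : ℕ} (hm : 0 < m) (hk : 0 < k)
    (h : ((2 * N + k - 1).choose k : ℝ) * Real.exp (-(m / 12)) < 1) :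
    ∃ A : Fin m → Fin N → Bool, ∀ y : Fin N → ℝ, (∀ r, signSum (A r) y = 0) →
      ∑ i, y i ^ 2 ≤ 18 / k * (∑ i, |y i|) ^ 2 := by
  have hcard : Fintype.card (Sym (Fin N × Bool) k) = (2 * N + k - 1).choose k := by
    rw [Sym.card_sym_eq_choose]; simp [mul_comm]
  obtain ⟨A, hA⟩ := exists_signs_sq_sum_ge (m := m) (fun s : Sym (Fin N × Bool) k =>
    ((s : Multiset (Fin N × Bool)).map signedBasis).sum) (by rw [hcard]; exact h)
  refine ⟨A, fun y hy => ?_⟩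
  set a := ∑ i, |y i| with ha
  have ha0 : 0 ≤ a := Finset.sum_nonneg fun i _ => abs_nonneg (y i)
  rcases ha0.eq_or_lt with h0 | h0
  · have : ∀ i, y i = 0 := fun i => abs_eq_zero.mp
      ((Finset.sum_eq_zero_iff_of_nonneg fun i _ => abs_nonneg (y i)).mp h0.symm i
        (Finset.mem_univ i))
    simp only [this]
    simp; positivity
  · have hb := sum_sq_le_of_signSum_eq_zero hm hk A hA (a⁻¹ • y) (fun r => by simp [hy r]) (by
      simp only [Pi.smul_apply, smul_eq_mul, abs_mul, ← Finset.mul_sum, ← ha,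
        abs_of_pos (inv_pos.mpr h0)]
      exact inv_mul_cancel₀ h0.ne')
    simp only [Pi.smul_apply, smul_eq_mul, mul_pow, ← Finset.mul_sum] at hb
    rwa [inv_pow, inv_mul_le_iff₀ (by positivity), mul_comm] at hb

lemma pNorm_top_eq_norm {N : ℕ} (x : Fin N → ℝ) : pNorm ∞ x = ‖x‖ := by
  rw [pNorm, if_pos rfl]
  refine le_antisymm (Real.iSup_le (fun i => norm_le_pi_norm x i) (norm_nonneg x)) ?_
  exact (pi_norm_le_iff_of_nonneg (Real.iSup_nonneg fun i => abs_nonneg (x i))).mpr fun i =>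
    le_ciSup (f := fun i => |x i|) (Set.finite_range _).bddAbove i

lemma sInf_pNorm_top_eq_infDist {N : ℕ} (V : Submodule ℝ (Fin N → ℝ)) (x : Fin N → ℝ) :
    sInf { t : ℝ | ∃ v ∈ V, t = pNorm ∞ (x - v) } = Metric.infDist x V := by
  rw [Metric.infDist_eq_iInf, iInf]
  congr 1
  ext t
  simp [pNorm_top_eq_norm, dist_eq_norm, eq_comm]

lemma kolmogorovNumber_top_le {p : ℝ≥0∞} {N n : ℕ} {D : ℝ} (hD : 0 ≤ D)
    (V : Submodule ℝ (Fin N → ℝ)) (hV : Module.finrank ℝ V < n)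
    (h : ∀ x : Fin N → ℝ, pNorm p x ≤ 1 → Metric.infDist x V ≤ D) :
    kolmogorovNumber p ∞ N n ≤ D := by
  unfold kolmogorovNumber
  refine le_trans (csInf_le ⟨0, ?_⟩ ⟨V, hV, rfl⟩) (Real.sSup_le ?_ hD)
  · rintro r ⟨W, -, rfl⟩
    refine Real.sSup_nonneg ?_
    rintro s ⟨x, -, rfl⟩
    rw [sInf_pNorm_top_eq_infDist]
    exact Metric.infDist_nonneg
  · rintro s ⟨x, hx, rfl⟩
    rw [sInf_pNorm_top_eq_infDist]
    exact h x hx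

lemma kolmogorovNumber_top_nonneg (p : ℝ≥0∞) (N n : ℕ) : 0 ≤ kolmogorovNumber p ∞ N n := by
  refine Real.sInf_nonneg ?_
  rintro r ⟨W, -, rfl⟩
  refine Real.sSup_nonneg ?_
  rintro s ⟨x, -, rfl⟩
  rw [sInf_pNorm_top_eq_infDist]
  exact Metric.infDist_nonneg

/-- Duality for the distance to a subspace in `ℓ_∞`. -/
lemma exists_annihilator_infDist {N : ℕ} (V : Submodule ℝ (Fin N → ℝ)) (x : Fin N → ℝ) :
    ∃ y : Fin N → ℝ, (∀ v ∈ V, ∑ i, y i * v i = 0) ∧ ∑ i, |y i| ≤ 1 ∧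
      Metric.infDist x V = ∑ i, y i * x i := by
  obtain ⟨g, hg, hgx⟩ := exists_dual_vector'' ℝ (V.mkQ x)
  have hrep : ∀ v, g (V.mkQ v) = ∑ i, g (V.mkQ (Pi.single i 1)) * v i := fun v => by
    conv_lhs => rw [pi_eq_sum_univ' v]
    simp only [map_sum, map_smul, smul_eq_mul, mul_comm]
  refine ⟨fun i => g (V.mkQ (Pi.single i 1)), fun v hv => ?_, ?_, ?_⟩
  · rw [← hrep, (Submodule.Quotient.mk_eq_zero V).mpr hv |> fun h => (h : V.mkQ v = 0), map_zero]
  · have hs := hrep fun i => SignType.sign (g (V.mkQ (Pi.single i 1)))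
    simp only [self_mul_sign] at hs
    rw [← hs]
    refine (le_abs_self _).trans ((g.le_opNorm _).trans ?_)
    refine mul_le_one₀ hg (norm_nonneg _) ((Submodule.Quotient.norm_mk_le V _).trans ?_)
    refine (pi_norm_le_iff_of_nonneg zero_le_one).mpr fun i => ?_
    generalize SignType.sign (g (V.mkQ (Pi.single i 1))) = σ
    cases σ <;> simp
  · rw [← hrep, hgx]
    exact (QuotientAddGroup.norm_mk (S := V.toAddSubgroup) x).symm

lemma abs_le_one_of_pNorm_le_one {p : ℝ} (hp : 1 ≤ p) {N : ℕ} {x : Fin N → ℝ}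
    (hx : pNorm (ENNReal.ofReal p) x ≤ 1) :
    (∀ i, |x i| ≤ 1) ∧ ∑ i, |x i| ^ p ≤ 1 := by
  have hp0 : 0 < p := by linarith
  rw [pNorm, if_neg ENNReal.ofReal_ne_top, ENNReal.toReal_ofReal hp0.le] at hx
  have hnn : ∀ i ∈ Finset.univ, 0 ≤ |x i| ^ p := fun i _ => by positivity
  have hs : ∑ i, |x i| ^ p ≤ 1 := by
    by_contra! hcon
    exact hx.not_gt (Real.one_lt_rpow hcon (by positivity))
  refine ⟨fun i => ?_, hs⟩
  by_contra! hcon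
  have := Finset.single_le_sum hnn (Finset.mem_univ i)
  linarith [Real.one_lt_rpow hcon hp0]

lemma sum_sq_le_one_of_pNorm_le_one {p : ℝ} (hp : 1 ≤ p) (hp2 : p ≤ 2) {N : ℕ} {x : Fin N → ℝ}
    (hx : pNorm (ENNReal.ofReal p) x ≤ 1) : ∑ i, x i ^ 2 ≤ 1 := by
  obtain ⟨h1, h2⟩ := abs_le_one_of_pNorm_le_one hp hx
  refine (Finset.sum_le_sum fun i _ => ?_).trans h2
  rw [← sq_abs, ← Real.rpow_two]
  exact Real.rpow_le_rpow_of_exponent_ge' (abs_nonneg _) (h1 i) (by linarith) hp2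

lemma kolmogorovNumber_le_one {p : ℝ} (hp : 1 ≤ p) {N n : ℕ} (hn : 1 ≤ n) :
    kolmogorovNumber (ENNReal.ofReal p) ∞ N n ≤ 1 := by
  refine kolmogorovNumber_top_le zero_le_one ⊥ (by rw [finrank_bot]; omega) fun x hx => ?_
  simp only [Submodule.bot_coe, Metric.infDist_singleton, dist_zero_right]
  exact (pi_norm_le_iff_of_nonneg zero_le_one).mpr (abs_le_one_of_pNorm_le_one hp hx).1

lemma kolmogorovNumber_eq_zero {p : ℝ≥0∞} {N n : ℕ} (h : N < n) :
    kolmogorovNumber p ∞ N n = 0 := by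
  refine le_antisymm (kolmogorovNumber_top_le le_rfl ⊤ (by simpa using h) fun x _ => ?_)
    (kolmogorovNumber_top_nonneg p N n)
  exact (Metric.infDist_zero_of_mem (by simp)).le

lemma kolmogorovNumber_le_sqrt {p : ℝ} (hp : 1 ≤ p) (hp2 : p ≤ 2) {N m k : ℕ} (hm : 0 < m)
    (hk : 0 < k) (h : ((2 * N + k - 1).choose k : ℝ) * Real.exp (-(m / 12)) < 1) :
    kolmogorovNumber (ENNReal.ofReal p) ∞ N (m + 1) ≤ √(18 / k) := by
  obtain ⟨A, hA⟩ := exists_signs_sum_sq_le hm hk h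
  let rows : Fin m → Fin N → ℝ := fun r i => boolSign (A r i)
  refine kolmogorovNumber_top_le (Real.sqrt_nonneg _) (Submodule.span ℝ (Set.range rows))
    (Nat.lt_succ_of_le ((finrank_range_le_card rows).trans (by simp))) fun x hx => ?_
  obtain ⟨y, hy0, hy1, hyx⟩ := exists_annihilator_infDist (Submodule.span ℝ (Set.range rows)) x
  have hyA := hA y fun r => by
    rw [signSum_apply, ← hy0 (rows r) (Submodule.subset_span ⟨r, rfl⟩)]
    simp only [rows, mul_comm]
  have hx2 := sum_sq_le_one_of_pNorm_le_one hp hp2 hx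
  rw [hyx]
  refine Real.le_sqrt_of_sq_le ((Finset.sum_mul_sq_le_sq_mul_sq _ _ _).trans ?_)
  have hy2 : ∑ i, y i ^ 2 ≤ 18 / k := hyA.trans (mul_le_of_le_one_right (by positivity)
    (pow_le_one₀ (Finset.sum_nonneg fun i _ => abs_nonneg (y i)) hy1))
  calc (∑ i, y i ^ 2) * ∑ i, x i ^ 2 ≤ (18 / k) * 1 := by gcongr
    _ = 18 / k := mul_one _

lemma choose_le_exp_mul_log {N k : ℕ} (hk : 0 < k) (hkN : k ≤ N) :
    ((2 * N + k - 1).choose k : ℝ) ≤ Real.exp (k * Real.log (3 * Real.exp 1 * N / k)) := by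
  have hk' : (0 : ℝ) < k := by exact_mod_cast hk
  have hN : (0 : ℝ) < N := by exact_mod_cast hk.trans_le hkN
  have hbase : ((2 * N + k - 1 : ℕ) : ℝ) ≤ 3 * N := by
    exact_mod_cast (show 2 * N + k - 1 ≤ 3 * N by omega)
  have hexp := Real.pow_div_factorial_le_exp (k : ℝ) hk'.le k
  calc ((2 * N + k - 1).choose k : ℝ)
      ≤ ((2 * N + k - 1 : ℕ) : ℝ) ^ k / k.factorial := Nat.choose_le_pow_div k _
    _ ≤ (3 * N) ^ k / k.factorial := by gcongr
    _ = (3 * N / k) ^ k * ((k : ℝ) ^ k / k.factorial) := by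
        rw [div_pow]; field_simp
    _ ≤ (3 * N / k) ^ k * Real.exp k := by gcongr
    _ = (3 * Real.exp 1 * N / k) ^ k := by
        rw [← Real.exp_one_pow k, ← mul_pow]; congr 1; ring
    _ = Real.exp (k * Real.log (3 * Real.exp 1 * N / k)) := by
        rw [Real.exp_nat_mul, Real.exp_log (by positivity)]

lemma one_le_log_four_exp_mul_div {N n : ℕ} (hn : 1 ≤ n) (hnN : n ≤ N) :
    1 ≤ Real.log (4 * Real.exp 1 * N / n) := by
  have hn' : (0 : ℝ) < n := by exact_mod_cast hn
  have hnN' : (n : ℝ) ≤ N := by exact_mod_cast hnN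
  have hN : (0 : ℝ) < N := hn'.trans_le hnN'
  have he := Real.exp_pos 1
  rw [Real.le_log_iff_exp_le (by positivity), le_div_iff₀ hn']
  nlinarith

lemma choose_mul_exp_neg_lt_one {N n k : ℕ} (hk : 0 < k) (hkN : k ≤ N) (hn : 1000 ≤ n)
    (hnN : n ≤ N) {L : ℝ} (hL : L = Real.log (4 * Real.exp 1 * N / n))
    (hkn : 1000 * L * k ≤ n) (hnk : n ≤ 2000 * L * k) :
    ((2 * N + k - 1).choose k : ℝ) * Real.exp (-((n - 1 : ℕ) / 12)) < 1 := by
  have hL1 : 1 ≤ L := hL ▸ one_le_log_four_exp_mul_div (by omega) hnN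
  have hk' : (0 : ℝ) < k := by exact_mod_cast hk
  have hn' : (1000 : ℝ) ≤ n := by exact_mod_cast hn
  have hn0 : (0 : ℝ) < n := by linarith
  have hN : (0 : ℝ) < N := by exact_mod_cast hk.trans_le hkN
  have h1500 : Real.log 1500 ≤ 8 := by
    rw [Real.log_le_iff_le_exp (by norm_num)]
    calc (1500 : ℝ) ≤ 2.7 ^ 8 := by norm_num
      _ ≤ Real.exp 1 ^ 8 := by
        gcongr
        linarith [Real.exp_one_gt_d9]
      _ = Real.exp 8 := by rw [← Real.exp_nat_mul]; norm_num
  have hlog : Real.log (3 * Real.exp 1 * N / k) ≤ 9 * L := by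
    calc Real.log (3 * Real.exp 1 * N / k)
        ≤ Real.log (4 * Real.exp 1 * N / n * (1500 * L)) := by
          refine Real.log_le_log (by positivity) ?_
          rw [div_mul_eq_mul_div, div_le_div_iff₀ hk' (by positivity)]
          have : 3 * Real.exp 1 * N * n ≤ 3 * Real.exp 1 * N * (2000 * L * k) := by gcongr
          linarith
      _ = L + (Real.log 1500 + Real.log L) := by
          rw [Real.log_mul (by positivity) (by positivity),
            Real.log_mul (by norm_num) (by positivity), hL]
      _ ≤ 9 * L := by
          have := Real.log_le_sub_one_of_pos (show 0 < L by linarith)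
          linarith
  calc ((2 * N + k - 1).choose k : ℝ) * Real.exp (-((n - 1 : ℕ) / 12))
      ≤ Real.exp (k * (9 * L)) * Real.exp (-((n - 1 : ℕ) / 12)) := by
        gcongr
        refine (choose_le_exp_mul_log hk hkN).trans ?_
        gcongr
    _ < 1 := by
        rw [← Real.exp_add, Real.exp_lt_one_iff, Nat.cast_sub (by omega)]
        push_cast
        linarith

lemma rpow_mul_rpow_eq_sqrt {a L : ℝ} (ha : 0 < a) (hL : 0 ≤ L) :
    200 * a ^ (-(1 / 2) : ℝ) * L ^ ((3 : ℝ) / 2) = √(40000 * L ^ 3 / a) := by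
  rw [Real.sqrt_div (by positivity), Real.sqrt_mul (by norm_num),
    show (40000 : ℝ) = 200 ^ 2 by norm_num, Real.sqrt_sq (by norm_num), Real.rpow_neg ha.le,
    ← Real.sqrt_eq_rpow, Real.sqrt_eq_rpow (L ^ 3), ← Real.rpow_natCast_mul hL]
  norm_num
  ring

/-- For `1 ≤ p₁ < 2` there is `C > 0`, independent of `N` and `n`, such that
`d_n(id : ℓ_{p₁}^N → ℓ_∞^N) ≤ C·n^{-1/2}·(log(4eN/n))^{3/2}` for `1 ≤ n ≤ N`,
and `d_n(id : ℓ_{p₁}^N → ℓ_∞^N) = 0` for `n > N`. -/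
theorem kolmogorov_lp_linfty_upper' (p₁ : ℝ) (hp1 : 1 ≤ p₁) (hp2 : p₁ < 2) :
    ∃ C : ℝ, 0 < C ∧ ∀ N n : ℕ,
      (1 ≤ n → n ≤ N →
        kolmogorovNumber (ENNReal.ofReal p₁) ∞ N n ≤
          C * (n : ℝ) ^ (-(1/2) : ℝ) *
            (Real.log (4 * Real.exp 1 * N / n)) ^ ((3 : ℝ)/2)) ∧
      (n > N → kolmogorovNumber (ENNReal.ofReal p₁) ∞ N n = 0) := by
  refine ⟨200, by norm_num, fun N n => ⟨fun hn hnN => ?_, kolmogorovNumber_eq_zero⟩⟩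
  have hL1 := one_le_log_four_exp_mul_div hn hnN
  set L := Real.log (4 * Real.exp 1 * N / n) with hL
  have hn' : (0 : ℝ) < n := by exact_mod_cast hn
  have hL3 : L ≤ L ^ 3 := le_self_pow₀ hL1 (by norm_num)
  rw [rpow_mul_rpow_eq_sqrt hn' (by linarith)]
  rcases lt_or_ge (n : ℝ) (1000 * L) with hsmall | hlarge
  · refine (kolmogorovNumber_le_one hp1 hn).trans (Real.one_le_sqrt.mpr ?_)
    rw [one_le_div hn']
    linarith
  · have h1000 : 1000 ≤ n := by
      have : (1000 : ℝ) ≤ n := by linarith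
      exact_mod_cast this
    have hpos : 0 < 1000 * L := by linarith
    set k := ⌊(n : ℝ) / (1000 * L)⌋₊ with hk
    have hk1 : 1 ≤ k := Nat.le_floor (by rw [Nat.cast_one, one_le_div hpos]; exact hlarge)
    have hk1' : (1 : ℝ) ≤ k := by exact_mod_cast hk1
    have hkn : 1000 * L * k ≤ n := by
      have := Nat.floor_le (show 0 ≤ (n : ℝ) / (1000 * L) by positivity)
      rw [← hk, le_div_iff₀ hpos] at this
      linarith
    have hnk : (n : ℝ) ≤ 2000 * L * k := by
      have := Nat.lt_floor_add_one ((n : ℝ) / (1000 * L))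
      rw [← hk, div_lt_iff₀ hpos] at this
      nlinarith
    have hkN : k ≤ N := by
      have : (k : ℝ) ≤ n := by nlinarith
      exact le_trans (by exact_mod_cast this) hnN
    have hmain := kolmogorovNumber_le_sqrt hp1 hp2.le (m := n - 1) (by omega) hk1
      (choose_mul_exp_neg_lt_one hk1 hkN h1000 hnN hL hkn hnk)
    rw [Nat.sub_add_cancel hn] at hmain
    refine hmain.trans (Real.sqrt_le_sqrt ?_)
    rw [div_le_div_iff₀ (by linarith) hn']
    nlinarith
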